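/- For every c in the interval (1/2, 1], it holds that Q(c) = R·c·ln(2c). -/

import Mathlib

open Real

noncomputable def R : ℝ := 1 / (1 + Real.log 2)

noncomputable def f (x : ℝ) : ℝ :=
  if x ≤ R then 1/2 else (2 * Real.exp 1) ^ (x - 1)

noncomputable def F (x : ℝ) : ℝ :=
  if x ≤ R then x/2 else R * (2 * Real.exp 1) ^ (x - 1)

noncomputable def P (c : ℝ) : ℝ := ∫ y in (0:ℝ)..1, min (f y) c

noncomputable def Q (c : ℝ) : ℝ := ∫ y in (0:ℝ)..1, max (c - f y) 0

noncomputable def xic : ℝ := (1 + (2/3) * Real.log (4/3)) * R - 2/3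

noncomputable def phi : ℝ := (2/3) * xic / (2/3 - R + xic)

noncomputable def xi (x : ℝ) : ℝ :=
  if x ≤ 1/3 then xic / x else 9 * xic * (1 - 2 * x)

noncomputable def T (a b : ℝ) : ℝ := (a + b - 1/2) * (xi b - xi a)

noncomputable def pile (x : ℝ) : ℝ := max (2/3) (2 * x)

theorem R_pos : 0 < R := by
  have := Real.log_pos (by norm_num : (1:ℝ) < 2)
  unfold R
  positivity

theorem inv_R : R⁻¹ = 1 + Real.log 2 := by
  simp [R]

theorem R_mul_log_two : R * Real.log 2 = 1 - R := by
  have h : R * R⁻¹ = 1 := mul_inv_cancel₀ R_pos.ne'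
  rw [inv_R] at h
  linarith

theorem two_mul_exp_one_rpow (x : ℝ) :
    (2 * Real.exp 1) ^ (x - 1) = Real.exp ((x - 1) / R) := by
  rw [Real.rpow_def_of_pos (by positivity), Real.log_mul (by norm_num) (Real.exp_ne_zero 1),
    Real.log_exp, div_eq_mul_inv, inv_R]
  ring_nf

theorem exp_sub_one_div_R_le_iff {x c : ℝ} (hc : 0 < c) :
    Real.exp ((x - 1) / R) ≤ c ↔ x ≤ 1 + R * Real.log c := by
  rw [← Real.le_log_iff_exp_le hc, div_le_iff₀ R_pos, mul_comm, sub_le_iff_le_add, add_comm]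

theorem one_add_R_mul_log_half : 1 + R * Real.log (1 / 2) = R := by
  rw [one_div, Real.log_inv]
  linarith [R_mul_log_two]

theorem f_eq_max (x : ℝ) : f x = max (1 / 2) (Real.exp ((x - 1) / R)) := by
  have h := exp_sub_one_div_R_le_iff (x := x) (c := 1 / 2) (by norm_num)
  rw [one_add_R_mul_log_half] at h
  unfold f
  split_ifs with hx
  · rw [max_eq_left (h.2 hx)]
  · rw [two_mul_exp_one_rpow, max_eq_right (not_le.1 (mt h.1 hx)).le]

theorem continuous_f : Continuous f := by
  rw [funext f_eq_max]
  fun_prop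

theorem integral_exp_sub_one_div_R (a b : ℝ) :
    ∫ x in a..b, Real.exp ((x - 1) / R) =
      R * Real.exp ((b - 1) / R) - R * Real.exp ((a - 1) / R) := by
  refine intervalIntegral.integral_eq_sub_of_hasDerivAt
    (f := fun x => R * Real.exp ((x - 1) / R)) (fun x _ => ?_)
    (Continuous.intervalIntegrable (by fun_prop) a b)
  have h := ((((hasDerivAt_id' x).sub_const 1).div_const R).exp).const_mul R
  rwa [mul_left_comm, mul_one_div_cancel R_pos.ne', mul_one] at h

theorem stmt_5 : ∀ c ∈ Set.Ioc (1/2 : ℝ) 1, Q c = R * c * Real.log (2 * c) := by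
  rintro c ⟨hc, hc1⟩
  have hc0 : 0 < c := by linarith
  have hR := R_pos
  have hcont : Continuous fun y => max (c - f y) 0 := by
    have := continuous_f
    fun_prop
  have hint (a b : ℝ) := hcont.intervalIntegrable (μ := MeasureTheory.volume) a b
  obtain ⟨t, ht⟩ : ∃ t, t = 1 + R * Real.log c := ⟨_, rfl⟩
  have hexp (x : ℝ) : Real.exp ((x - 1) / R) ≤ c ↔ x ≤ t :=
    ht ▸ exp_sub_one_div_R_le_iff hc0
  have hhalf (x : ℝ) : Real.exp ((x - 1) / R) ≤ 1 / 2 ↔ x ≤ R := by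
    rw [exp_sub_one_div_R_le_iff (by norm_num), one_add_R_mul_log_half]
  have hRt : R ≤ t := (hexp R).1 (((hhalf R).2 le_rfl).trans hc.le)
  have ht1 : t ≤ 1 := by nlinarith [Real.log_nonpos hc0.le hc1]
  have hexp_t : Real.exp ((t - 1) / R) = c := by
    rw [ht, add_sub_cancel_left, mul_div_cancel_left₀ _ hR.ne', Real.exp_log hc0]
  have hexp_R : Real.exp ((R - 1) / R) = 1 / 2 := by
    have : (R - 1) / R = Real.log (1 / 2) := by
      rw [div_eq_iff hR.ne']
      linarith [one_add_R_mul_log_half]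
    rw [this, Real.exp_log (by norm_num)]
  have left : ∫ y in (0:ℝ)..R, max (c - f y) 0 = R * (c - 1 / 2) := by
    rw [intervalIntegral.integral_congr (g := fun _ => c - 1 / 2)]
    · simp [mul_sub]
    · intro y hy
      rw [Set.uIcc_of_le hR.le] at hy
      simp only [f, if_pos hy.2]
      exact max_eq_left (by linarith)
  have middle : ∫ y in R..t, max (c - f y) 0 = (t - R) * c - (R * c - R * (1 / 2)) := by
    rw [intervalIntegral.integral_congr (g := fun y => c - Real.exp ((y - 1) / R)),
      intervalIntegral.integral_sub (by simp) (Continuous.intervalIntegrable (by fun_prop) _ _),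
      integral_exp_sub_one_div_R, hexp_t, hexp_R]
    · simp
    · intro y hy
      rw [Set.uIcc_of_le hRt] at hy
      have h : 1 / 2 ≤ Real.exp ((y - 1) / R) := by
        rw [← hexp_R]
        gcongr
        exact hy.1
      simp only [f_eq_max, max_eq_right h]
      exact max_eq_left (sub_nonneg.2 ((hexp y).2 hy.2))
  have right : ∫ y in t..1, max (c - f y) 0 = 0 := by
    rw [intervalIntegral.integral_congr (g := fun _ => 0)]
    · simp
    · intro y hy
      rw [Set.uIcc_of_le ht1] at hy
      have h : c ≤ Real.exp ((y - 1) / R) := by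
        rw [← hexp_t]
        gcongr
        exact hy.1
      exact max_eq_right (sub_nonpos.2 (h.trans (f_eq_max y ▸ le_max_right _ _)))
  rw [Q, ← intervalIntegral.integral_add_adjacent_intervals (hint 0 R) (hint R 1),
    ← intervalIntegral.integral_add_adjacent_intervals (hint R t) (hint t 1),
    left, middle, right, Real.log_mul (by norm_num) hc0.ne', ht]
  linear_combination -c * R_mul_log_two
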